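/- Let K/k be a finite Galois extension of degree ℓ whose Galois group is cyclic, generated by θ, let v = (v_1,…,v_m) ∈ K^m be a Gabidulin vector normalised so that v_1 = 1, let 1 ≤ d < m, and let F := k(v_2,…,v_m). Then the left idealiser of C̃(v,θ,d), namely the set L := {φ ∈ End_k(K) : for every c = (c_1,…,c_m) ∈ C̃(v,θ,d), (φ(c_1),…,φ(c_m)) ∈ C̃(v,θ,d)}, equals the centralizer in End_k(K) of the multiplication operators {μ_a : a ∈ F}; equivalently L = End_F(K), which is isomorphic as a k-algebra to the algebra of s×s matrices over F, where s = [K:F]. -/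

import Mathlib

set_option synthInstance.maxHeartbeats 1000000
set_option maxHeartbeats 1000000

/-- The Gabidulin-like code `C̃(v,θ,d) = span_K{v, θ(v), …, θ^{d−1}(v)} ≤ K^m`,
where `θ` acts entrywise on `K^m`. -/
def gabCode {k K : Type*} [Field k] [Field K] [Algebra k K] {m : ℕ}
    (θ : K ≃ₐ[k] K) (v : Fin m → K) (d : ℕ) : Submodule K (Fin m → K) :=
  Submodule.span K (Set.range fun i : Fin d => (fun j => (θ ^ (i : ℕ)) (v j) : Fin m → K))

/-- A `θ`-polynomial of degree less than `n` that vanishes at `n` elements which are linearly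
independent over the fixed field of `θ` is zero. -/
theorem eq_zero_of_sum_mul_pow_apply_eq_zero {k K : Type*} [Field k] [Field K] [Algebra k K]
    (θ : K ≃ₐ[k] K) (hfix : ∀ x : K, θ x = x → ∃ a : k, algebraMap k K a = x) (n : ℕ)
    (v : Fin n → K) (hv : LinearIndependent k v) (c : ℕ → K)
    (h : ∀ j, ∑ i ∈ Finset.range n, c i * (θ ^ i) (v j) = 0) : ∀ i < n, c i = 0 := by
  induction n generalizing c with
  | zero => intro i hi; omega
  | succ n ih =>
    have hv0 : v 0 ≠ 0 := hv.ne_zero 0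
    set b : ℕ → K := fun i => c i * (θ ^ i) (v 0) with hb
    set u : Fin (n + 1) → K := fun j => v j / v 0 with hu
    set e : ℕ → K := fun i => ∑ t ∈ Finset.range (i + 1), b t with he
    have hθv (i : ℕ) : (θ ^ i) (v 0) ≠ 0 := (map_ne_zero _).2 hv0
    have hbu (j) : ∑ i ∈ Finset.range (n + 1), b i * (θ ^ i) (u j) = 0 := by
      rw [← h j]
      refine Finset.sum_congr rfl fun i _ => ?_
      simp only [hb, hu, map_div₀]
      rw [mul_assoc, mul_div_cancel₀ _ (hθv i)]
    have he_last : e n = 0 := by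
      rw [he, ← hbu 0]
      simp [hu, hv0]
    have sum_by_parts (x : ℕ → K) (N : ℕ) : ∑ i ∈ Finset.range (N + 1), b i * x i
        = e N * x N - ∑ i ∈ Finset.range N, e i * (x (i + 1) - x i) := by
      induction N with
      | zero => simp [he]
      | succ N ihN =>
        have : e (N + 1) = e N + b (N + 1) := Finset.sum_range_succ _ _
        rw [Finset.sum_range_succ, ihN, Finset.sum_range_succ _ N, this]
        ring
    have hw : LinearIndependent k fun j : Fin n => θ (u j.succ) - u j.succ := by
      rw [Fintype.linearIndependent_iff] at hv ⊢
      intro g hg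
      obtain ⟨a, ha⟩ := hfix (∑ j, g j • u j.succ) (by
        rw [← sub_eq_zero, map_sum, ← Finset.sum_sub_distrib, ← hg]
        simp [smul_sub])
      have := hv (Fin.cons (-a) g) (by
        rw [Fin.sum_univ_succ]
        simp only [Fin.cons_zero, Fin.cons_succ]
        have hs : ∑ j, g j • v j.succ = v 0 * ∑ j, g j • u j.succ := by
          rw [Finset.mul_sum]
          refine Finset.sum_congr rfl fun j _ => ?_
          rw [mul_smul_comm]
          congr 1
          simp only [hu]
          field_simp
        rw [hs, ← ha, neg_smul, Algebra.smul_def]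
        ring)
      intro j
      simpa using this j.succ
    have he0 : ∀ i < n, e i = 0 := by
      refine ih _ hw e fun j => ?_
      have := sum_by_parts (fun i => (θ ^ i) (u j.succ)) n
      rw [hbu, he_last, zero_mul, zero_sub, eq_comm, neg_eq_zero] at this
      rw [← this]
      refine Finset.sum_congr rfl fun i _ => ?_
      rw [map_sub, pow_succ, AlgEquiv.mul_apply]
    have he1 : ∀ i < n + 1, e i = 0 := fun i hi => by
      rcases Nat.lt_succ_iff_lt_or_eq.1 hi with h | rfl
      exacts [he0 i h, he_last]
    intro i hi
    have hbi : b i = 0 := by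
      cases i with
      | zero => simpa [he] using he1 0 hi
      | succ i =>
        have : e (i + 1) = e i + b (i + 1) := Finset.sum_range_succ _ _
        rwa [he1 _ hi, he1 i (by omega), zero_add, eq_comm] at this
    exact (mul_eq_zero.1 hbi).resolve_right (hθv i)

theorem mem_gabCode_iff {k K : Type*} [Field k] [Field K] [Algebra k K] {m : ℕ}
    {θ : K ≃ₐ[k] K} {v : Fin m → K} {d : ℕ} {x : Fin m → K} :
    x ∈ gabCode θ v d ↔
      ∃ c : ℕ → K, ∀ j, x j = ∑ i ∈ Finset.range d, c i * (θ ^ i) (v j) := by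
  rw [gabCode, Submodule.mem_span_range_iff_exists_fun]
  constructor
  · rintro ⟨c, rfl⟩
    refine ⟨fun i => if h : i < d then c ⟨i, h⟩ else 0, fun j => ?_⟩
    rw [Finset.sum_range]
    simp
  · rintro ⟨c, hc⟩
    refine ⟨fun i => c i, ?_⟩
    ext j
    rw [hc, Finset.sum_range]
    simp

/-- If `x` and `θ x` both lie in the code of dimension `d + 1 < m`, then `x` lies in the code of
dimension `d`. -/
theorem mem_gabCode_of_mem_succ {k K : Type*} [Field k] [Field K] [Algebra k K]
    {θ : K ≃ₐ[k] K} (hfix : ∀ x : K, θ x = x → ∃ a : k, algebraMap k K a = x) {m : ℕ}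
    {v : Fin m → K} (hv : LinearIndependent k v) {d : ℕ} (hd : d + 1 < m) {x : Fin m → K}
    (hx : x ∈ gabCode θ v (d + 1)) (hθx : (fun j => θ (x j)) ∈ gabCode θ v (d + 1)) :
    x ∈ gabCode θ v d := by
  obtain ⟨c, hc⟩ := mem_gabCode_iff.1 hx
  obtain ⟨b, hb⟩ := mem_gabCode_iff.1 hθx
  have hvanish := eq_zero_of_sum_mul_pow_apply_eq_zero θ hfix (d + 2)
    (fun j => v (Fin.castLE hd j)) (hv.comp _ (Fin.castLE_injective hd))
    (fun i => (if i = 0 then 0 else θ (c (i - 1))) - if i < d + 1 then b i else 0) (fun j => by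
      have h := hb (Fin.castLE hd j)
      simp only [hc, map_sum, map_mul] at h
      simp only [sub_mul, Finset.sum_sub_distrib]
      rw [Finset.sum_range_succ' _ (d + 1), Finset.sum_range_succ (n := d + 1), sub_eq_zero]
      simp only [pow_succ'] at h ⊢
      simp only [AlgEquiv.mul_apply, Nat.add_eq_zero_iff, one_ne_zero, and_false, if_false,
        Nat.add_sub_cancel, if_true, zero_mul, add_zero, lt_irrefl]
      rw [h]
      refine Finset.sum_congr rfl fun i hi => ?_
      rw [if_pos (Finset.mem_range.1 hi)])
  have hcd : c d = 0 := by simpa using hvanish (d + 1) (by omega)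
  refine mem_gabCode_iff.2 ⟨c, fun j => ?_⟩
  rw [hc, Finset.sum_range_succ, hcd, zero_mul, add_zero]

/-- An automorphism commuting with `θ` that stabilises a code of dimension `1 ≤ d < m` fixes the
normalised Gabidulin vector defining it. -/
theorem apply_eq_self_of_stabilises_gabCode {k K : Type*} [Field k] [Field K] [Algebra k K]
    {θ : K ≃ₐ[k] K} (hfix : ∀ x : K, θ x = x → ∃ a : k, algebraMap k K a = x)
    {σ : K ≃ₐ[k] K} (hσ : Commute σ θ) {m : ℕ}
    {v : Fin m → K} (hv : LinearIndependent k v) (hm : 0 < m) (hv1 : v ⟨0, hm⟩ = 1)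
    {d : ℕ} (hdm : d + 1 < m)
    (hstab : ∀ i < d + 1, (fun j => σ ((θ ^ i) (v j))) ∈ gabCode θ v (d + 1)) (j : Fin m) :
    σ (v j) = v j := by
  induction d with
  | zero =>
    obtain ⟨c, hc⟩ := mem_gabCode_iff.1 (hstab 0 (by omega))
    have h0 := hc ⟨0, hm⟩
    have hj := hc j
    simp only [pow_zero, AlgEquiv.one_apply, zero_add, Finset.sum_range_one, hv1, map_one,
      mul_one] at h0 hj
    rw [hj, ← h0, one_mul]
  | succ d ih =>
    refine ih (by omega) fun i hi => mem_gabCode_of_mem_succ hfix hv hdm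
      (hstab i (by omega)) ?_
    convert hstab (i + 1) (by omega) using 2 with j
    rw [pow_succ', AlgEquiv.mul_apply, ← AlgEquiv.mul_apply σ θ, hσ.eq, AlgEquiv.mul_apply]

/-- Every `k`-linear endomorphism of a finite Galois extension is a combination of
automorphisms. -/
theorem exists_eq_sum_smul_algEquiv {k K : Type*} [Field k] [Field K] [Algebra k K]
    [FiniteDimensional k K] [IsGalois k K] (φ : Module.End k K) :
    ∃ a : (K ≃ₐ[k] K) → K, ∀ x, φ x = ∑ σ, a σ * σ x := by
  have hli : LinearIndependent K fun σ : K ≃ₐ[k] K => (σ.toLinearMap : K →ₗ[k] K) :=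
    (linearIndependent_toLinearMap k K K).comp (fun σ : K ≃ₐ[k] K => σ.toAlgHom)
      AlgEquiv.coe_toAlgHom_injective
  have hcard : Fintype.card (K ≃ₐ[k] K) = Module.finrank K (K →ₗ[k] K) := by
    rw [Module.finrank_linearMap_self, ← Nat.card_eq_fintype_card,
      IsGalois.card_aut_eq_finrank]
  have hspan := hli.span_eq_top_of_card_eq_finrank' hcard
  obtain ⟨a, ha⟩ := (Submodule.mem_span_range_iff_exists_fun K).1
    (hspan ▸ Submodule.mem_top : (φ : K →ₗ[k] K) ∈ _)
  refine ⟨a, fun x => ?_⟩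
  rw [← ha]
  simp

/-- If all the combinations `∑ σ, σ x • w σ` with `x ∈ K` lie in a subspace, then so does every
`w σ`. -/
theorem mem_of_forall_sum_apply_smul_mem {k K V : Type*} [Field k] [Field K] [Algebra k K]
    [FiniteDimensional k K] [AddCommGroup V] [Module K V] (C : Submodule K V)
    (w : (K ≃ₐ[k] K) → V) (h : ∀ x : K, ∑ σ, σ x • w σ ∈ C) (σ : K ≃ₐ[k] K) : w σ ∈ C := by
  rw [← Subspace.forall_mem_dualAnnihilator_apply_eq_zero_iff]
  intro f hf
  have hli : LinearIndependent K fun σ : K ≃ₐ[k] K => (σ.toLinearMap : K →ₗ[k] K) :=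
    (linearIndependent_toLinearMap k K K).comp (fun σ : K ≃ₐ[k] K => σ.toAlgHom)
      AlgEquiv.coe_toAlgHom_injective
  refine Fintype.linearIndependent_iff.1 hli (fun σ => f (w σ)) ?_ σ
  ext x
  have := (Submodule.mem_dualAnnihilator f).1 hf _ (h x)
  simpa [mul_comm] using this

/-- The centraliser of the multiplications by elements of an intermediate field `F` is the algebra
of `F`-linear endomorphisms. -/
def centralizerLmulEquivEnd {k K : Type*} [Field k] [Field K] [Algebra k K]
    (F : IntermediateField k K) :
    Subalgebra.centralizer k ((fun a : K => (Algebra.lmul k K a : Module.End k K)) '' (F : Set K))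
      ≃ₐ[k] Module.End F K where
  toFun φ :=
    { toFun := φ.1
      map_add' := map_add φ.1
      map_smul' := fun a x =>
        (LinearMap.congr_fun (φ.2 _ (Set.mem_image_of_mem _ a.2)) x).symm }
  invFun ψ := ⟨ψ.restrictScalars k, by
    rintro _ ⟨a, ha, rfl⟩
    ext x
    exact (ψ.map_smul ⟨a, ha⟩ x).symm⟩
  left_inv _ := rfl
  right_inv _ := rfl
  map_mul' _ _ := rfl
  map_add' _ _ := rfl
  commutes' _ := rfl

/-- **The left idealiser of a Gabidulin-like code.**
Let `K/k` be finite cyclic Galois of degree `ℓ` generated by `θ`, let `v ∈ K^m` be a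
Gabidulin vector normalised so that `v_1 = 1`, let `1 ≤ d < m`, and let
`F := k(v_2,…,v_m)`.  Then the left idealiser
`L = {φ ∈ End_k(K) : φ (entrywise) maps C̃(v,θ,d) into itself}` equals the centraliser
in `End_k(K)` of the multiplication operators `{μ_a : a ∈ F}`, i.e. `L = End_F(K)`,
which is isomorphic as a `k`-algebra to `F^{s×s}` with `s = [K:F]`. -/
theorem left_idealiser_of_gabCode {k K : Type*} [Field k] [Field K] [Algebra k K]
    [FiniteDimensional k K] [IsGalois k K]
    (θ : K ≃ₐ[k] K) (hθ : ∀ σ : K ≃ₐ[k] K, σ ∈ Subgroup.zpowers θ)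
    {m : ℕ} (v : Fin m → K)
    (hv : Module.finrank k (Submodule.span k (Set.range v)) = m)
    (hm : 0 < m) (hv1 : v ⟨0, hm⟩ = 1)
    (d : ℕ) (hd1 : 1 ≤ d) (hdm : d < m) :
    {φ : Module.End k K | ∀ c ∈ gabCode θ v d, (fun j => φ (c j) : Fin m → K) ∈ gabCode θ v d}
      = (Subalgebra.centralizer k
          ((fun a : K => (Algebra.lmul k K a : Module.End k K)) ''
            (IntermediateField.adjoin k (v '' {j : Fin m | (j : ℕ) ≠ 0}) : Set K)) :
          Set (Module.End k K)) ∧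
    Nonempty
      ((Subalgebra.centralizer k
          ((fun a : K => (Algebra.lmul k K a : Module.End k K)) ''
            (IntermediateField.adjoin k (v '' {j : Fin m | (j : ℕ) ≠ 0}) : Set K))) ≃ₐ[k]
        Matrix
          (Fin (Module.finrank (IntermediateField.adjoin k (v '' {j : Fin m | (j : ℕ) ≠ 0})) K))
          (Fin (Module.finrank (IntermediateField.adjoin k (v '' {j : Fin m | (j : ℕ) ≠ 0})) K))
          (IntermediateField.adjoin k (v '' {j : Fin m | (j : ℕ) ≠ 0}))) := by
  set F := IntermediateField.adjoin k (v '' {j : Fin m | (j : ℕ) ≠ 0}) with hF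
  have hli : LinearIndependent k v := by
    rw [linearIndependent_iff_card_eq_finrank_span, Set.finrank, hv, Fintype.card_fin]
  have hcomm (σ τ : K ≃ₐ[k] K) : Commute σ τ := by
    obtain ⟨a, rfl⟩ := Subgroup.mem_zpowers_iff.1 (hθ σ)
    obtain ⟨b, rfl⟩ := Subgroup.mem_zpowers_iff.1 (hθ τ)
    exact Commute.zpow_zpow_self θ a b
  have hfix (x : K) (hx : θ x = x) : ∃ a : k, algebraMap k K a = x := by
    refine (IsGalois.mem_bot_iff_fixed x).2 fun σ => ?_
    have hle : Subgroup.zpowers θ ≤ MulAction.stabilizer (K ≃ₐ[k] K) x := by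
      rw [Subgroup.zpowers_le]
      exact hx
    exact hle (hθ σ)
  have hvF (j : Fin m) : v j ∈ F := by
    by_cases hj : (j : ℕ) = 0
    · have : j = ⟨0, hm⟩ := Fin.ext hj
      rw [this, hv1]
      exact one_mem F
    · exact IntermediateField.subset_adjoin k _ ⟨j, hj, rfl⟩
  have hstableF (σ : K ≃ₐ[k] K) (x : K) (hx : x ∈ F) : σ x ∈ F := by
    rw [← IsGalois.fixedField_fixingSubgroup F, IntermediateField.mem_fixedField_iff]
    intro τ hτ
    rw [← AlgEquiv.mul_apply, (hcomm τ σ).eq, AlgEquiv.mul_apply,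
      (IntermediateField.mem_fixingSubgroup_iff F τ).1 hτ x hx]
  refine ⟨?_, ⟨(centralizerLmulEquivEnd F).trans
    ((algEquivMatrix (Module.finBasis F K)).restrictScalars k)⟩⟩
  ext φ
  constructor
  · intro hφ
    obtain ⟨a, ha⟩ := exists_eq_sum_smul_algEquiv φ
    have hσF (σ : K ≃ₐ[k] K) (hσ : a σ ≠ 0) (x : K) (hx : x ∈ F) : σ x = x := by
      obtain ⟨d, rfl⟩ := Nat.exists_eq_add_of_le' hd1
      have hσv := apply_eq_self_of_stabilises_gabCode hfix (hcomm σ θ) hli hm hv1 hdm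
        fun i hi => by
          have hc : (fun j => (θ ^ i) (v j)) ∈ gabCode θ v (d + 1) :=
            Submodule.subset_span ⟨⟨i, hi⟩, rfl⟩
          have := mem_of_forall_sum_apply_smul_mem (gabCode θ v (d + 1))
            (fun σ => a σ • fun j => σ ((θ ^ i) (v j))) (fun x => by
              convert hφ _ (Submodule.smul_mem _ x hc) using 1
              ext j
              simp [ha, mul_left_comm]) σ
          exact (Submodule.smul_mem_iff _ hσ).1 this
      have hle : F ≤ IntermediateField.fixedField (Subgroup.zpowers σ) := by
        rw [hF, IntermediateField.adjoin_le_iff]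
        rintro _ ⟨j, -, rfl⟩
        rw [SetLike.mem_coe, IntermediateField.mem_fixedField_iff]
        have hle : Subgroup.zpowers σ ≤ MulAction.stabilizer (K ≃ₐ[k] K) (v j) := by
          rw [Subgroup.zpowers_le]
          exact hσv j
        exact fun τ hτ => hle hτ
      exact (IntermediateField.mem_fixedField_iff _ _).1 (hle hx) σ (Subgroup.mem_zpowers σ)
    rintro _ ⟨b, hb, rfl⟩
    ext x
    simp only [Module.End.mul_apply, Algebra.coe_lmul_eq_mul, LinearMap.mul_apply', ha,
      Finset.mul_sum, map_mul]
    refine Finset.sum_congr rfl fun σ _ => ?_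
    by_cases hσ : a σ = 0
    · simp [hσ]
    · rw [hσF σ hσ b hb, mul_left_comm]
  · intro hφ c hc
    obtain ⟨a, ha⟩ := mem_gabCode_iff.1 hc
    refine mem_gabCode_iff.2 ⟨fun i => φ (a i), fun j => ?_⟩
    rw [ha, map_sum]
    refine Finset.sum_congr rfl fun i _ => ?_
    have := LinearMap.congr_fun
      (hφ _ (Set.mem_image_of_mem _ (hstableF (θ ^ i) _ (hvF j)))) (a i)
    simp only [Module.End.mul_apply, Algebra.coe_lmul_eq_mul, LinearMap.mul_apply'] at this
    rw [mul_comm, ← this, mul_comm]
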